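/- arXiv:math/0110275 — 4 statements merged into one kernel-verified Lean document; each statement's English description precedes it below -/
import Mathlib

section
/- Let $A$ be a (possibly noncommutative) ring, let $r \in \mathbb{N}$, let $k_1, \dots, k_r \in A$, let $l \in A$, and let $m = (m_1,\dots,m_r) \in \mathbb{N}^r$ be a multi-index. Then $l \cdot (k_1^{m_1} k_2^{m_2} \cdots k_r^{m_r}) = \sum_{p \le m} \left( \prod_{i=1}^{r} \binom{m_i}{p_i} \right) \, k_1^{m_1-p_1} k_2^{m_2-p_2} \cdots k_r^{m_r-p_r} \cdot \big( \widetilde{\mathrm{ad}}_{k_r}^{p_r} \circ \cdots \circ \widetilde{\mathrm{ad}}_{k_2}^{p_2} \circ \widetilde{\mathrm{ad}}_{k_1}^{p_1} \big)(l)$, where the sum runs over all multi-indices $p = (p_1,\dots,p_r) \in \mathbb{N}^r$ with $p_i \le m_i$ for every $i$. -/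
/-- The one-variable commutation formula: expand right multiplication by `a ^ n`
binomially as the sum of left multiplication by `a` and `x ↦ x * a - a * x`. -/
theorem mul_pow_eq_sum_choose_smul {A : Type*} [Ring A] (a l : A) (n : ℕ) :
    l * a ^ n = ∑ j ∈ Finset.Iic n,
      n.choose j • (a ^ (n - j) * (fun y => y * a - a * y)^[j] l) := by
  have hc : Commute (LinearMap.mulRight ℤ a - LinearMap.mulLeft ℤ a)
      (LinearMap.mulLeft ℤ a) :=
    ((LinearMap.commute_mulLeft_right (R := ℤ) a a).symm).sub_left (Commute.refl _)
  have had : ⇑(LinearMap.mulRight ℤ a - LinearMap.mulLeft ℤ a) =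
      fun y => y * a - a * y := by
    ext y; simp
  have h := congrArg (fun f : Module.End ℤ A => f l) (hc.add_pow n)
  simp only [sub_add_cancel, LinearMap.pow_mulRight, LinearMap.mulRight_apply] at h
  rw [h, LinearMap.sum_apply, Nat.range_succ_eq_Iic]
  refine Finset.sum_congr rfl fun j _ => ?_
  rw [(hc.pow_pow j (n - j)).eq, ← nsmul_eq_mul', LinearMap.smul_apply, Module.End.mul_apply,
    LinearMap.pow_mulLeft, LinearMap.mulLeft_apply, Module.End.pow_apply, had]

/-- A sum over the multi-indices below `m` splits off its first index. -/
theorem sum_Iic_fin_succ {M : Type*} [AddCommMonoid M] {r : ℕ} (m : Fin (r + 1) → ℕ)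
    (f : (Fin (r + 1) → ℕ) → M) :
    ∑ p ∈ Finset.Iic m, f p =
      ∑ j ∈ Finset.Iic (m 0), ∑ q ∈ Finset.Iic (fun i => m i.succ), f (Fin.cons j q) := by
  rw [← Finset.sum_product']
  refine Finset.sum_nbij' (fun p => (p 0, fun i => p i.succ)) (fun x => Fin.cons x.1 x.2)
    ?_ ?_ ?_ ?_ ?_
  · intro p hp
    simp only [Finset.mem_Iic, Finset.mem_product] at hp ⊢
    exact ⟨hp 0, fun i => hp i.succ⟩
  · intro x hx
    simp only [Finset.mem_Iic, Finset.mem_product] at hx ⊢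
    exact Fin.cases hx.1 hx.2
  · intro p _
    exact Fin.cons_self_tail p
  · intro x _
    simp
  · intro p _
    exact congrArg f (Fin.cons_self_tail p).symm

/-- **Multi-index commutation formula in a bicrossproduct-type algebra.**
For elements `k 1, ..., k r` and `l` of a ring `A` and a multi-index `m`,
`l * (k 1 ^ m 1 * ⋯ * k r ^ m r)
  = ∑_{p ≤ m} (∏ i, (m i choose p i)) * (k 1 ^ (m 1 - p 1) * ⋯ * k r ^ (m r - p r))
      * (ãd_{k r}^[p r] ∘ ⋯ ∘ ãd_{k 1}^[p 1]) l`,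
where `ãd_a x = x * a - a * x`. -/
theorem mul_ordered_prod_pow_eq_sum (A : Type*) [Ring A] (r : ℕ) (k : Fin r → A)
    (l : A) (m : Fin r → ℕ) :
    l * (List.ofFn fun i => k i ^ m i).prod =
      ∑ p ∈ Finset.Iic m,
        (∏ i, (m i).choose (p i)) •
          ((List.ofFn fun i => k i ^ (m i - p i)).prod *
            (List.ofFn (id : Fin r → Fin r)).foldl
              (fun x i => (fun y => y * k i - k i * y)^[p i] x) l) := by
  induction r generalizing l with
  | zero => simp [show Finset.Iic m = {m} from by ext p; simp [Subsingleton.elim p m]]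
  | succ r ih =>
    rw [sum_Iic_fin_succ, List.ofFn_succ, List.prod_cons, ← mul_assoc,
      mul_pow_eq_sum_choose_smul, Finset.sum_mul]
    refine Finset.sum_congr rfl fun j _ => ?_
    rw [smul_mul_assoc, mul_assoc, ih (fun i => k i.succ), Finset.mul_sum, Finset.smul_sum]
    refine Finset.sum_congr rfl fun q _ => ?_
    have hs : (List.ofFn fun i : Fin r => i.succ) =
        (List.ofFn (id : Fin r → Fin r)).map Fin.succ := by
      rw [List.map_ofFn]; rfl
    simp only [List.ofFn_succ, Fin.prod_univ_succ, Fin.cons_zero, Fin.cons_succ,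
      List.prod_cons, List.foldl_cons, hs, List.foldl_map, id_eq, mul_smul_comm, mul_smul,
      mul_assoc]
end

section
/- Let $K$ be a field and $V, V', W, W'$ be $K$-vector spaces. Let $B_1 : V \times V' \to K$ and $B_2 : W \times W' \to K$ be bilinear pairings that are both nondegenerate (i.e., $B_1(v, v') = 0$ for all $v'$ implies $v = 0$; $B_1(v,v') = 0$ for all $v$ implies $v' = 0$; and similarly for $B_2$). Then the bilinear pairing $B : (V \otimes_K W) \times (V' \otimes_K W') \to K$ determined on simple tensors by $B(v \otimes w, v' \otimes w') = B_1(v, v') \, B_2(w, w')$ is nondegenerate. -/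
open TensorProduct

/-- If `B1` and `B2` separate points on the left, then so does any pairing on the tensor products
which is given on pure tensors by the product of `B1` and `B2`. -/
theorem tensor_pairing_separatingLeft {K V V' W W' : Type*} [Field K]
    [AddCommGroup V] [Module K V] [AddCommGroup V'] [Module K V']
    [AddCommGroup W] [Module K W] [AddCommGroup W'] [Module K W']
    {B1 : V →ₗ[K] V' →ₗ[K] K} {B2 : W →ₗ[K] W' →ₗ[K] K}
    (h1 : B1.SeparatingLeft) (h2 : B2.SeparatingLeft)
    {B : V ⊗[K] W →ₗ[K] V' ⊗[K] W' →ₗ[K] K}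
    (hB : ∀ v w v' w', B (v ⊗ₜ[K] w) (v' ⊗ₜ[K] w') = B1 v v' * B2 w w') :
    B.SeparatingLeft := by
  intro x hx
  let e := Module.Basis.ofVectorSpace K W
  obtain ⟨c, rfl⟩ := TensorProduct.eq_repr_basis_right e x
  have hc (v' : V') : (c.sum fun i v => B1 v v' • e i) = 0 := by
    refine h2 _ fun w' => ?_
    simpa [Finsupp.sum, hB] using hx (v' ⊗ₜ[K] w')
  have hc0 : c = 0 := by
    ext i
    refine h1 _ fun v' => ?_
    by_cases hi : i ∈ c.support
    · exact linearIndependent_iff'.mp e.linearIndependent _ _ (hc v') i hi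
    · simp [Finsupp.notMem_support_iff.mp hi]
  simp [hc0]

/-- **Nondegeneracy of the tensor product of nondegenerate pairings.**
If `B1 : V × V' → K` and `B2 : W × W' → K` are nondegenerate bilinear pairings over a
field `K`, then the pairing `B` on `(V ⊗ W) × (V' ⊗ W')` determined by
`B (v ⊗ w) (v' ⊗ w') = B1 v v' * B2 w w'` is nondegenerate. -/
theorem tensor_pairing_nondegenerate (K V V' W W' : Type*) [Field K]
    [AddCommGroup V] [Module K V] [AddCommGroup V'] [Module K V']
    [AddCommGroup W] [Module K W] [AddCommGroup W'] [Module K W']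
    (B1 : V →ₗ[K] V' →ₗ[K] K) (B2 : W →ₗ[K] W' →ₗ[K] K)
    (h1left : ∀ v : V, (∀ v' : V', B1 v v' = 0) → v = 0)
    (h1right : ∀ v' : V', (∀ v : V, B1 v v' = 0) → v' = 0)
    (h2left : ∀ w : W, (∀ w' : W', B2 w w' = 0) → w = 0)
    (h2right : ∀ w' : W', (∀ w : W, B2 w w' = 0) → w' = 0)
    (B : V ⊗[K] W →ₗ[K] V' ⊗[K] W' →ₗ[K] K)
    (hB : ∀ (v : V) (w : W) (v' : V') (w' : W'),
      B (v ⊗ₜ[K] w) (v' ⊗ₜ[K] w') = B1 v v' * B2 w w') :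
    (∀ x : V ⊗[K] W, (∀ y : V' ⊗[K] W', B x y = 0) → x = 0) ∧
    (∀ y : V' ⊗[K] W', (∀ x : V ⊗[K] W, B x y = 0) → y = 0) := by
  refine ⟨tensor_pairing_separatingLeft h1left h2left hB, ?_⟩
  exact tensor_pairing_separatingLeft (B1 := B1.flip) (B2 := B2.flip) (B := B.flip)
    h1right h2right fun v' w' v w => hB v w v' w'
end

section
/- Let $z \ne 0$ be a real number and consider the vector field $\hat{K}(\alpha_-,\alpha_+) = \big(2\alpha_-, \tfrac{1}{z}(e^{-2 z \alpha_+} - 1)\big)$ on $\mathbb{R}^2$. The function $h : \mathbb{R}^2 \to \mathbb{R}$, $h(\alpha_-, \alpha_+) = \alpha_- (e^{2 z \alpha_+} - 1)$, is a first integral of $\hat{K}$: at every point $(\alpha_-,\alpha_+) \in \mathbb{R}^2$ the directional derivative of $h$ along $\hat{K}$ vanishes, i.e. $2\alpha_- \, \partial_{\alpha_-} h + \tfrac{1}{z}(e^{-2 z \alpha_+} - 1) \, \partial_{\alpha_+} h = 0$ (equivalently, the Fréchet derivative of $h$ at $(\alpha_-,\alpha_+)$ applied to $\hat{K}(\alpha_-,\alpha_+)$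 is zero). Consequently $h$ is constant along the flow: $h(\Phi^s(\alpha_-,\alpha_+)) = h(\alpha_-,\alpha_+)$ whenever $\Phi^s(\alpha_-,\alpha_+)$ is defined. -/
/-- The null-plane quantum Poincaré flow
`Φ^s(α₋, α₊) = (α₋ e^{2s}, (1/(2z)) log(1 - e^{-2s}(1 - e^{2zα₊})))`,
defined whenever `1 - e^{-2s}(1 - e^{2zα₊}) > 0`. -/
noncomputable def npFlow (z : ℝ) (s : ℝ) (p : ℝ × ℝ) : ℝ × ℝ :=
  (p.1 * Real.exp (2 * s),
    1 / (2 * z) * Real.log (1 - Real.exp (-(2 * s)) * (1 - Real.exp (2 * z * p.2))))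

/-- The first integral `h(α₋, α₊) = α₋ (e^{2zα₊} - 1)` of the null-plane quantum
Poincaré vector field. -/
noncomputable def npFirstIntegral (z : ℝ) (p : ℝ × ℝ) : ℝ :=
  p.1 * (Real.exp (2 * z * p.2) - 1)

/-- The Fréchet derivative of `npFirstIntegral`. -/
theorem hasFDerivAt_npFirstIntegral (z : ℝ) (p : ℝ × ℝ) :
    HasFDerivAt (npFirstIntegral z)
      (p.1 • Real.exp (2 * z * p.2) • (2 * z) • ContinuousLinearMap.snd ℝ ℝ ℝ +
        (Real.exp (2 * z * p.2) - 1) • ContinuousLinearMap.fst ℝ ℝ ℝ) p :=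
  hasFDerivAt_fst.mul ((hasFDerivAt_snd.const_mul (2 * z)).exp.sub_const 1)

/-- **`h(α₋, α₊) = α₋(e^{2zα₊} - 1)` is a first integral of the vector field
`K̂(α₋, α₊) = (2α₋, (1/z)(e^{-2zα₊} - 1))`:** the Fréchet derivative of `h` applied to
`K̂` vanishes at every point, and consequently `h` is constant along the flow `Φ^s`
wherever the latter is defined. -/
theorem npFirstIntegral_invariant (z : ℝ) (hz : z ≠ 0) :
    (∀ p : ℝ × ℝ,
      fderiv ℝ (npFirstIntegral z) p (2 * p.1, 1 / z * (Real.exp (-(2 * z * p.2)) - 1)) = 0) ∧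
    (∀ p : ℝ × ℝ, ∀ s : ℝ,
      1 - Real.exp (-(2 * s)) * (1 - Real.exp (2 * z * p.2)) > 0 →
        npFirstIntegral z (npFlow z s p) = npFirstIntegral z p) := by
  refine ⟨fun p => ?_, fun p s hs => ?_⟩
  · rw [(hasFDerivAt_npFirstIntegral z p).fderiv, Real.exp_neg]
    simp only [add_apply, smul_apply, ContinuousLinearMap.coe_fst',
      ContinuousLinearMap.coe_snd', smul_eq_mul]
    field_simp
    ring
  · simp only [npFirstIntegral, npFlow]
    rw [← mul_assoc, mul_one_div_cancel (mul_ne_zero two_ne_zero hz), one_mul, Real.exp_log hs,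
      Real.exp_neg]
    field_simp
    ring
end

section
/- Let $\kappa \ne 0$ be a real number. The function $h : \mathbb{R}^2 \to \mathbb{R}$, $h(a, b) = a \, e^{b/(2\kappa)}$, is invariant under the quantum $\kappa$-Galilei flow: for every $(a,b) \in \mathbb{R}^2$ and every $s \in \mathbb{R}$ with $1 - \tfrac{s a}{2\kappa} > 0$, $h\big(\Phi^s(a,b)\big) = h(a,b)$. Equivalently, $h$ is a first integral of the vector field $\hat{K}(a,b) = \big(\tfrac{a^2}{2\kappa}, -a\big)$: the directional derivative $\tfrac{a^2}{2\kappa} \, \partial_a h - a \, \partial_b h$ vanishes at every point of $\mathbb{R}^2$. -/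
/-- The quantum κ-Galilei flow
`Φ^s(a, b) = (a/(1 - sa/(2κ)), b + 2κ log(1 - sa/(2κ)))`,
defined whenever `1 - sa/(2κ) > 0`. -/
noncomputable def kgFlow (κ : ℝ) (s : ℝ) (p : ℝ × ℝ) : ℝ × ℝ :=
  (p.1 / (1 - s * p.1 / (2 * κ)), p.2 + 2 * κ * Real.log (1 - s * p.1 / (2 * κ)))

/-- The first integral `h(a, b) = a e^{b/(2κ)}` of the quantum κ-Galilei vector
field. -/
noncomputable def kgFirstIntegral (κ : ℝ) (p : ℝ × ℝ) : ℝ :=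
  p.1 * Real.exp (p.2 / (2 * κ))

theorem hasFDerivAt_kgFirstIntegral (κ : ℝ) (p : ℝ × ℝ) :
    HasFDerivAt (kgFirstIntegral κ)
      (p.1 • Real.exp (p.2 / (2 * κ)) • (2 * κ)⁻¹ • ContinuousLinearMap.snd ℝ ℝ ℝ +
        Real.exp (p.2 / (2 * κ)) • ContinuousLinearMap.fst ℝ ℝ ℝ) p := by
  have hsnd : HasFDerivAt (fun q : ℝ × ℝ => q.2 / (2 * κ))
      ((2 * κ)⁻¹ • ContinuousLinearMap.snd ℝ ℝ ℝ) p := by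
    simpa only [div_eq_mul_inv] using hasFDerivAt_snd.mul_const (2 * κ)⁻¹
  exact hasFDerivAt_fst.mul hsnd.exp

/-- **`h(a, b) = a e^{b/(2κ)}` is invariant under the quantum κ-Galilei flow:**
`h(Φ^s(a,b)) = h(a,b)` whenever `1 - sa/(2κ) > 0`, and `h` is a first integral of the
vector field `K̂(a, b) = (a²/(2κ), -a)`: the Fréchet derivative of `h` applied to `K̂`
vanishes at every point. -/
theorem kgFirstIntegral_invariant (κ : ℝ) (hκ : κ ≠ 0) :
    (∀ p : ℝ × ℝ, ∀ s : ℝ, 1 - s * p.1 / (2 * κ) > 0 →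
      kgFirstIntegral κ (kgFlow κ s p) = kgFirstIntegral κ p) ∧
    (∀ p : ℝ × ℝ,
      fderiv ℝ (kgFirstIntegral κ) p (p.1 ^ 2 / (2 * κ), -p.1) = 0) := by
  refine ⟨fun p s hs => ?_, fun p => ?_⟩
  · have hexp : (p.2 + 2 * κ * Real.log (1 - s * p.1 / (2 * κ))) / (2 * κ) =
        p.2 / (2 * κ) + Real.log (1 - s * p.1 / (2 * κ)) := by
      rw [add_div, mul_div_cancel_left₀ _ (mul_ne_zero two_ne_zero hκ)]
    simp only [kgFirstIntegral, kgFlow]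
    rw [hexp, Real.exp_add, Real.exp_log hs, mul_comm (Real.exp _), ← mul_assoc,
      div_mul_cancel₀ _ hs.ne']
  · rw [(hasFDerivAt_kgFirstIntegral κ p).fderiv]
    simp only [add_apply, smul_apply, ContinuousLinearMap.coe_fst', ContinuousLinearMap.coe_snd',
      smul_eq_mul]
    ring
end
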